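/- arXiv:1302.0406 — 2 statements merged into one kernel-verified Lean document; each statement's English description precedes it below -/
import Mathlib

section
/- Fix r > 0, n ≥ 2, and define g : (X × {−1,1})ⁿ → ℝ by g(S) = sup_{μ : ‖μ‖₂ ≤ r} ( R(μ) − R̂_S(μ) ). Then g satisfies the bounded-differences property with constant (2/n)(1 + r‖κ‖₂): for any two samples S and S' that differ in exactly one coordinate (one pair (xᵢ,yᵢ) replaced by another point of X × {−1,1}), we have |g(S) − g(S')| ≤ (2/n)(1 + r‖κ‖₂). -/
open MeasureTheory Finset

noncomputable section

/-- The ±1 real value of a Boolean label: `true ↦ 1`, `false ↦ -1`.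
We encode the label space {−1, 1} by `Bool`. -/
def sgn (b : Bool) : ℝ := if b then 1 else -1

/-- The Euclidean (L2) norm on ℝᵖ. -/
def l2norm {p : ℕ} (μ : Fin p → ℝ) : ℝ := Real.sqrt (∑ i, μ i ^ 2)

/-- The L1 norm on ℝᵖ. -/
def l1norm {p : ℕ} (μ : Fin p → ℝ) : ℝ := ∑ i, |μ i|

/-- The L∞ (supremum) norm on ℝᵖ. -/
def linfnorm {p : ℕ} (μ : Fin p → ℝ) : ℝ := ⨆ i, |μ i|

/-- The standard inner product on ℝᵖ. -/
def ip {p : ℕ} (μ v : Fin p → ℝ) : ℝ := ∑ i, μ i * v i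

/-- The K-space feature map `z(x,x') = (K₁(x,x'),…,K_p(x,x'))`. -/
def zmap {X : Type*} {p : ℕ} (K : Fin p → X → X → ℝ) (x x' : X) : Fin p → ℝ :=
  fun i => K i x x'

/-- The pairwise hinge loss `ℓ(μ, (x,y), (x',y')) = max(0, 1 − y y' ⟨μ, z(x,x')⟩)`. -/
def hinge {X : Type*} {p : ℕ} (K : Fin p → X → X → ℝ) (μ : Fin p → ℝ)
    (w w' : X × Bool) : ℝ :=
  max 0 (1 - sgn w.2 * sgn w'.2 * ip μ (zmap K w.1 w'.1))

/-- The empirical risk `R̂_S(μ) = (2/(n(n−1))) Σ_{1≤i<j≤n} ℓ(μ, (xᵢ,yᵢ), (xⱼ,yⱼ))`. -/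
def empRisk {X : Type*} {p n : ℕ} (K : Fin p → X → X → ℝ)
    (S : Fin n → X × Bool) (μ : Fin p → ℝ) : ℝ :=
  (2 / ((n : ℝ) * ((n : ℝ) - 1))) *
    ∑ i : Fin n, ∑ j : Fin n, if i < j then hinge K μ (S i) (S j) else 0

/-- The true risk `R(μ) = E_{((x,y),(x',y')) ~ D×D}[max(0, 1 − y y' ⟨μ, z(x,x')⟩)]`. -/
def trueRisk {X : Type*} [MeasurableSpace X] {p : ℕ} (K : Fin p → X → X → ℝ)
    (D : Measure (X × Bool)) (μ : Fin p → ℝ) : ℝ :=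
  ∫ w, hinge K μ w.1 w.2 ∂(D.prod D)

/-- Expectation over m i.i.d. Rademacher random variables (uniform on {−1,+1}),
encoded by Booleans mapped to ±1 via `sgn`. -/
def radE {m : ℕ} (f : (Fin m → Bool) → ℝ) : ℝ :=
  (∑ ε : Fin m → Bool, f ε) / 2 ^ m

lemma abs_sgn (b : Bool) : |sgn b| = 1 := by
  cases b <;> simp [sgn]

lemma l2norm_nonneg {p : ℕ} (v : Fin p → ℝ) : 0 ≤ l2norm v :=
  Real.sqrt_nonneg _

lemma abs_ip_le {p : ℕ} (u v : Fin p → ℝ) : |ip u v| ≤ l2norm u * l2norm v := by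
  unfold ip l2norm
  rw [← Real.sqrt_mul (Finset.sum_nonneg fun i _ => sq_nonneg _)]
  exact Real.abs_le_sqrt (Finset.sum_mul_sq_le_sq_mul_sq _ _ _)

lemma l2norm_le_of_abs_le {p : ℕ} {u v : Fin p → ℝ} (h : ∀ i, |u i| ≤ v i) :
    l2norm u ≤ l2norm v :=
  Real.sqrt_le_sqrt (Finset.sum_le_sum fun i _ =>
    sq_le_sq.mpr ((h i).trans (le_abs_self _)))

lemma hinge_nonneg {X : Type*} {p : ℕ} (K : Fin p → X → X → ℝ) (μ : Fin p → ℝ)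
    (w w' : X × Bool) : 0 ≤ hinge K μ w w' :=
  le_max_left _ _

lemma hinge_le {X : Type*} {p : ℕ} {K : Fin p → X → X → ℝ} {c μ : Fin p → ℝ} {r : ℝ}
    (hK : ∀ i x x', |K i x x'| ≤ c i) (hμ : l2norm μ ≤ r) (w w' : X × Bool) :
    hinge K μ w w' ≤ 1 + r * l2norm c := by
  have hr : 0 ≤ r := (l2norm_nonneg μ).trans hμ
  have hip : |sgn w.2 * sgn w'.2 * ip μ (zmap K w.1 w'.1)| ≤ r * l2norm c := by
    rw [abs_mul, abs_mul, abs_sgn, abs_sgn, one_mul, one_mul]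
    exact (abs_ip_le _ _).trans
      (mul_le_mul hμ (l2norm_le_of_abs_le fun i => hK i _ _) (l2norm_nonneg _) hr)
  refine max_le ?_ ?_
  · linarith [mul_nonneg hr (l2norm_nonneg c)]
  · linarith [neg_abs_le (sgn w.2 * sgn w'.2 * ip μ (zmap K w.1 w'.1))]

/-- A sum over pairs `i < j` supported on the pairs containing a given index has at most `n - 1`
nonzero terms. -/
lemma sum_lt_le_of_support {n : ℕ} (i₀ : Fin n) {f : Fin n → Fin n → ℝ} {B : ℝ}
    (hf : ∀ i j, f i j ≤ B) (h0 : ∀ i j, i ≠ i₀ → j ≠ i₀ → f i j = 0) :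
    ∑ i, ∑ j, (if i < j then f i j else 0) ≤ ((n : ℝ) - 1) * B := by
  calc ∑ i, ∑ j, (if i < j then f i j else 0)
      ≤ ∑ i, ∑ j, ((if i = i₀ then (if i₀ < j then B else 0) else 0) +
          (if j = i₀ then (if i < i₀ then B else 0) else 0)) := by
        refine Finset.sum_le_sum fun i _ => Finset.sum_le_sum fun j _ => ?_
        have h1 := hf i j
        have h2 := h0 i j
        grind
    _ = ∑ j, ((if i₀ < j then B else 0) + (if j < i₀ then B else 0)) := by
        simp only [Finset.sum_add_distrib]
        rw [Finset.sum_comm]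
        simp
    _ = ∑ j, (B - if j = i₀ then B else 0) :=
        Finset.sum_congr rfl fun j _ => by grind
    _ = ((n : ℝ) - 1) * B := by
        simp [Finset.sum_sub_distrib, sub_mul]

lemma empRisk_nonneg {X : Type*} {p n : ℕ} (hn : 1 ≤ n) (K : Fin p → X → X → ℝ)
    (S : Fin n → X × Bool) (μ : Fin p → ℝ) : 0 ≤ empRisk K S μ := by
  have hn' : (0 : ℝ) ≤ (n : ℝ) - 1 := sub_nonneg.mpr (by exact_mod_cast hn)
  refine mul_nonneg (by positivity) (Finset.sum_nonneg fun i _ => Finset.sum_nonneg fun j _ => ?_)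
  split_ifs
  exacts [hinge_nonneg _ _ _ _, le_rfl]

lemma empRisk_sub_le {X : Type*} {p n : ℕ} (hn : 2 ≤ n) {K : Fin p → X → X → ℝ}
    {c μ : Fin p → ℝ} {r : ℝ} (hK : ∀ i x x', |K i x x'| ≤ c i) (hμ : l2norm μ ≤ r)
    {S S' : Fin n → X × Bool} {i₀ : Fin n} (hS : ∀ i, i ≠ i₀ → S i = S' i) :
    empRisk K S μ - empRisk K S' μ ≤ (2 / (n : ℝ)) * (1 + r * l2norm c) := by
  have hn' : (0 : ℝ) < (n : ℝ) - 1 := sub_pos.mpr (by exact_mod_cast hn)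
  have hn0 : (0 : ℝ) < n := by linarith
  have hsum := sum_lt_le_of_support i₀
    (f := fun i j => hinge K μ (S i) (S j) - hinge K μ (S' i) (S' j))
    (fun i j => (sub_le_self _ (hinge_nonneg _ _ _ _)).trans (hinge_le hK hμ _ _))
    (fun i j hi hj => by rw [hS i hi, hS j hj, sub_self])
  calc empRisk K S μ - empRisk K S' μ
      = 2 / ((n : ℝ) * ((n : ℝ) - 1)) * ∑ i, ∑ j, (if i < j then
          hinge K μ (S i) (S j) - hinge K μ (S' i) (S' j) else 0) := by
        unfold empRisk
        rw [← mul_sub, ← Finset.sum_sub_distrib]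
        congr 1
        refine Finset.sum_congr rfl fun i _ => ?_
        rw [← Finset.sum_sub_distrib]
        exact Finset.sum_congr rfl fun j _ => by split_ifs <;> simp
    _ ≤ 2 / ((n : ℝ) * ((n : ℝ) - 1)) * (((n : ℝ) - 1) * (1 + r * l2norm c)) := by
        gcongr
    _ = (2 / (n : ℝ)) * (1 + r * l2norm c) := by
        field_simp

lemma trueRisk_le {X : Type*} [MeasurableSpace X] {p : ℕ} {K : Fin p → X → X → ℝ}
    {c μ : Fin p → ℝ} {r : ℝ} (hK : ∀ i x x', |K i x x'| ≤ c i) (hμ : l2norm μ ≤ r)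
    (D : Measure (X × Bool)) [IsProbabilityMeasure D] :
    trueRisk K D μ ≤ 1 + r * l2norm c := by
  have h := norm_integral_le_of_norm_le_const (μ := D.prod D)
    (f := fun w => hinge K μ w.1 w.2) (C := 1 + r * l2norm c)
    (Filter.Eventually.of_forall fun w => by
      rw [Real.norm_of_nonneg (hinge_nonneg _ _ _ _)]
      exact hinge_le hK hμ _ _)
  simpa [trueRisk] using (Real.le_norm_self _).trans h

lemma iSup_risk_gap_le {X : Type*} [MeasurableSpace X] {p n : ℕ} (hn : 2 ≤ n)
    {K : Fin p → X → X → ℝ} {c : Fin p → ℝ} (hK : ∀ i x x', |K i x x'| ≤ c i)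
    (D : Measure (X × Bool)) [IsProbabilityMeasure D] {r : ℝ} (hr : 0 ≤ r)
    {S S' : Fin n → X × Bool} {i₀ : Fin n} (hS : ∀ i, i ≠ i₀ → S i = S' i) :
    (⨆ μ : {μ : Fin p → ℝ // l2norm μ ≤ r}, (trueRisk K D μ.1 - empRisk K S μ.1)) ≤
      (⨆ μ : {μ : Fin p → ℝ // l2norm μ ≤ r}, (trueRisk K D μ.1 - empRisk K S' μ.1)) +
        (2 / (n : ℝ)) * (1 + r * l2norm c) := by
  have : Nonempty {μ : Fin p → ℝ // l2norm μ ≤ r} := ⟨0, by simpa [l2norm] using hr⟩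
  have hbdd : BddAbove (Set.range fun μ : {μ : Fin p → ℝ // l2norm μ ≤ r} =>
      trueRisk K D μ.1 - empRisk K S' μ.1) := by
    refine ⟨1 + r * l2norm c, ?_⟩
    rintro _ ⟨μ, rfl⟩
    exact (sub_le_self _ (empRisk_nonneg (by omega) K S' μ.1)).trans (trueRisk_le hK μ.2 D)
  refine ciSup_le fun μ => ?_
  have h1 := le_ciSup hbdd μ
  have h2 := empRisk_sub_le hn hK μ.2 (fun i hi => (hS i hi).symm)
  linarith

/-- the function g(S) = sup_{‖μ‖₂ ≤ r} (R(μ) − R̂_S(μ)) satisfies the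
bounded-differences property with constant (2/n)(1 + r‖κ‖₂). -/
theorem stmt3 {X : Type*} [MeasurableSpace X] {p n : ℕ} (hn : 2 ≤ n)
    (K : Fin p → X → X → ℝ)
    (hKm : ∀ i, Measurable (fun w : X × X => K i w.1 w.2))
    (κ : Fin p → ℝ) (hκ : ∀ i, 0 < κ i)
    (hKb : ∀ i x x', |K i x x'| ≤ κ i ^ 2)
    (D : Measure (X × Bool)) [IsProbabilityMeasure D]
    (r : ℝ) (hr : 0 < r)
    (S S' : Fin n → X × Bool)
    (hdiff : ∃ i₀ : Fin n, ∀ i, i ≠ i₀ → S i = S' i) :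
    |(⨆ μ : {μ : Fin p → ℝ // l2norm μ ≤ r}, (trueRisk K D μ.1 - empRisk K S μ.1)) -
      (⨆ μ : {μ : Fin p → ℝ // l2norm μ ≤ r}, (trueRisk K D μ.1 - empRisk K S' μ.1))| ≤
      (2 / (n : ℝ)) * (1 + r * l2norm (fun i => κ i ^ 2)) := by
  obtain ⟨i₀, hS⟩ := hdiff
  rw [abs_sub_le_iff, sub_le_iff_le_add', sub_le_iff_le_add']
  exact ⟨iSup_risk_gap_le hn hKb D hr.le hS,
    iSup_risk_gap_le hn hKb D hr.le fun i hi => (hS i hi).symm⟩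
end
end

section
/- Let {q_τ : X × X → ℝ}_{τ ∈ T} be a family of measurable real-valued functions indexed by a set T, uniformly bounded, and let X₁,…,Xₙ be i.i.d. random variables taking values in X with n even, n ≥ 2. Then E[ sup_{τ∈T} (2/(n(n−1))) Σ_{1≤i<j≤n} q_τ(Xᵢ, Xⱼ) ] ≤ E[ sup_{τ∈T} (2/n) Σ_{i=1}^{n/2} q_τ(Xᵢ, X_{n/2+i}) ]. -/
open MeasureTheory Finset

noncomputable section

/-- The sum over all permutations of a function of the images of two distinct points does not
depend on these points. -/
theorem sum_perm_apply_pair_eq {α : Type*} [Fintype α] [DecidableEq α] (g : α → α → ℝ)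
    {a b c d : α} (hab : a ≠ b) (hcd : c ≠ d) :
    ∑ σ : Equiv.Perm α, g (σ a) (σ b) = ∑ σ : Equiv.Perm α, g (σ c) (σ d) := by
  obtain ⟨π, hc, hd⟩ : ∃ π : Equiv.Perm α, π c = a ∧ π d = b := by
    refine ⟨Equiv.swap b (Equiv.swap c a d) * Equiv.swap c a, ?_, ?_⟩
    · rw [Equiv.Perm.mul_apply, Equiv.swap_apply_left, Equiv.swap_apply_of_ne_of_ne hab]
      intro h
      apply hcd
      apply (Equiv.swap c a).injective
      rw [← h, Equiv.swap_apply_left]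
    · rw [Equiv.Perm.mul_apply, Equiv.swap_apply_right]
  rw [← hc, ← hd]
  exact Equiv.sum_comp (Equiv.mulRight π) fun σ : Equiv.Perm α => g (σ c) (σ d)

/-- Averaging over permutations a function of the images of two distinct points amounts to
averaging over all ordered pairs of distinct points. -/
theorem card_mul_sum_perm_apply_pair {α : Type*} [Fintype α] [DecidableEq α] (g : α → α → ℝ)
    {a b : α} (hab : a ≠ b) :
    ((Fintype.card α : ℝ) * ((Fintype.card α : ℝ) - 1)) * ∑ σ : Equiv.Perm α, g (σ a) (σ b) =
      (Fintype.card (Equiv.Perm α) : ℝ) * ∑ p ∈ (univ : Finset α).offDiag, g p.1 p.2 := by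
  have h1 : ∑ p ∈ (univ : Finset α).offDiag, ∑ σ : Equiv.Perm α, g (σ p.1) (σ p.2) =
      ((Fintype.card α : ℝ) * ((Fintype.card α : ℝ) - 1)) *
        ∑ σ : Equiv.Perm α, g (σ a) (σ b) := by
    rw [sum_congr rfl fun p hp => sum_perm_apply_pair_eq g (mem_offDiag.1 hp).2.2 hab,
      sum_const, offDiag_card, nsmul_eq_mul, card_univ, Nat.cast_sub (Nat.le_mul_self _)]
    push_cast
    ring
  rw [← h1, sum_comm, Fintype.card, ← nsmul_eq_mul, ← sum_const]
  refine sum_congr rfl fun σ _ => ?_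
  refine sum_bij' (fun p _ => (σ p.1, σ p.2)) (fun p _ => (σ.symm p.1, σ.symm p.2))
    ?_ ?_ ?_ ?_ ?_ <;> simp

/-- Precomposition with a permutation of the coordinates preserves a product of equal measures. -/
theorem measurePreserving_comp_perm {ι 𝒳 : Type*} [Fintype ι] [MeasurableSpace 𝒳]
    (D : Measure 𝒳) [SigmaFinite D] (φ : Equiv.Perm ι) :
    MeasurePreserving (fun S : ι → 𝒳 => S ∘ φ)
      (Measure.pi fun _ => D) (Measure.pi fun _ => D) := by
  have h := measurePreserving_piCongrLeft (fun _ : ι => D) φ.symm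
  convert h using 1
  ext S i
  have hi := Equiv.piCongrLeft_apply_apply (fun _ : ι => 𝒳) φ.symm S (φ i)
  rw [Equiv.symm_apply_apply] at hi
  exact hi.symm

/-- The perfect matching of `Fin n` induced by a permutation can be oriented increasingly by
another permutation. -/
theorem exists_perm_min_max {n : ℕ} (hev : Even n) (σ : Equiv.Perm (Fin n)) :
    ∃ φ : Equiv.Perm (Fin n), ∀ a b : Fin n, a.1 < n / 2 → b.1 = n / 2 + a.1 →
      φ a = min (σ a) (σ b) ∧ φ b = max (σ a) (σ b) := by
  obtain ⟨m, hm⟩ := hev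
  let p : Fin n → Fin n := fun k =>
    if h : k.1 < n / 2 then ⟨n / 2 + k.1, by omega⟩ else ⟨k.1 - n / 2, by omega⟩
  have hpp : ∀ k, p (p k) = k := by
    intro k
    ext
    by_cases h : k.1 < n / 2
    · simp [p, h]
    · have : k.1 - n / 2 < n / 2 := by omega
      simp only [p, h, this, dite_true, dite_false]
      omega
  have hplt : ∀ k, (p k).1 < n / 2 ↔ ¬ k.1 < n / 2 := by
    intro k
    by_cases h : k.1 < n / 2
    · simp [p, h]
    · simp only [p, h, dite_false, not_false_eq_true, iff_true]
      omega
  have hne : ∀ k, σ k ≠ σ (p k) := by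
    intro k h
    have h2 := hplt k
    rw [← σ.injective h] at h2
    tauto
  let C : Fin n → Prop := fun k => (k.1 < n / 2 ↔ σ k < σ (p k))
  have hC : ∀ k, C (p k) ↔ C k := by
    intro k
    simp only [C, hpp, hplt]
    rcases lt_or_gt_of_ne (hne k) with h | h <;> simp only [h, h.not_gt] <;> tauto
  classical
  let t : Fin n → Fin n := fun k => if C k then k else p k
  have ht : Function.Involutive t := by
    intro k
    by_cases h : C k <;> simp [t, h, hC, hpp]
  refine ⟨σ * ht.toPerm, fun a b ha hb => ?_⟩
  have hpa : p a = b := by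
    ext
    simp [p, ha, hb]
  have hpb : p b = a := by rw [← hpa, hpp]
  have hb' : ¬ b.1 < n / 2 := by omega
  have hab := hne a
  rw [hpa] at hab
  simp only [Equiv.Perm.mul_apply, Function.Involutive.coe_toPerm, t, C, ha, hb', hpa, hpb]
  rcases lt_or_gt_of_ne hab with h | h <;> simp [h, h.le, h.not_gt]

/-- The U-statistic is the average over permutations of the statistics on the increasingly oriented
induced matchings. -/
theorem sum_lt_eq_average_matching {n : ℕ} (hn : 2 ≤ n) (hev : Even n) (f : Fin n → Fin n → ℝ)
    (lo hi : Fin (n / 2) → Fin n) (hne : ∀ i, lo i ≠ hi i) :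
    (2 / ((n : ℝ) * ((n : ℝ) - 1))) * ∑ i, ∑ j, (if i < j then f i j else 0) =
      (Fintype.card (Equiv.Perm (Fin n)) : ℝ)⁻¹ * ∑ σ : Equiv.Perm (Fin n),
        (2 / (n : ℝ)) * ∑ i, f (min (σ (lo i)) (σ (hi i))) (max (σ (lo i)) (σ (hi i))) := by
  have hn0 : (n : ℝ) ≠ 0 := by positivity
  have hn1 : (n : ℝ) - 1 ≠ 0 := by
    have : (2 : ℝ) ≤ n := by exact_mod_cast hn
    linarith
  have hN : (Fintype.card (Equiv.Perm (Fin n)) : ℝ) ≠ 0 := by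
    exact_mod_cast Fintype.card_ne_zero
  have hoff : ∑ p ∈ (univ : Finset (Fin n)).offDiag, f (min p.1 p.2) (max p.1 p.2) =
      2 * ∑ i, ∑ j, (if i < j then f i j else 0) := by
    have h1 : ∑ p ∈ (univ : Finset (Fin n)).offDiag, f (min p.1 p.2) (max p.1 p.2) =
        ∑ i, ∑ j, ((if i < j then f i j else 0) + (if j < i then f j i else 0)) := by
      rw [← Fintype.sum_prod_type'
        (f := fun i j => (if i < j then f i j else 0) + (if j < i then f j i else 0))]
      refine sum_subset_zero_on_sdiff (subset_univ _) ?_ ?_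
      · rintro ⟨i, j⟩ h
        have : i = j := by simpa using h
        simp [this]
      · rintro ⟨i, j⟩ h
        have : i ≠ j := by simpa using h
        rcases lt_or_gt_of_ne this with h | h <;> simp [h, h.le, h.not_gt]
    rw [h1]
    simp only [sum_add_distrib]
    rw [sum_comm (f := fun i j : Fin n => if j < i then f j i else 0)]
    ring
  have hpair : ∀ i, ∑ σ : Equiv.Perm (Fin n),
      f (min (σ (lo i)) (σ (hi i))) (max (σ (lo i)) (σ (hi i))) =
      (Fintype.card (Equiv.Perm (Fin n)) : ℝ) *
        (2 * ∑ i, ∑ j, (if i < j then f i j else 0)) / ((n : ℝ) * ((n : ℝ) - 1)) := by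
    intro i
    have h := card_mul_sum_perm_apply_pair (fun x y => f (min x y) (max x y)) (hne i)
    rw [hoff, Fintype.card_fin] at h
    rw [← h]
    field_simp
  have hhalf : ((n / 2 : ℕ) : ℝ) = n / 2 := by
    rw [Nat.cast_div hev.two_dvd (by norm_num)]
    norm_num
  rw [← mul_sum, sum_comm (γ := Equiv.Perm (Fin n)), sum_congr rfl fun i _ => hpair i, sum_const, card_univ,
    Fintype.card_fin, nsmul_eq_mul, hhalf]
  field_simp

/-- A scaled sum of `k` terms bounded by `B` is bounded uniformly. -/
theorem abs_mul_sum_le {ι : Type*} [Fintype ι] (c : ℝ) {B : ℝ} (f : ι → ℝ)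
    (hf : ∀ i, |f i| ≤ B) : |c * ∑ i, f i| ≤ |c| * (Fintype.card ι * B) := by
  rw [abs_mul]
  gcongr
  calc |∑ i, f i| ≤ ∑ i, |f i| := abs_sum_le_sum_abs _ _
    _ ≤ ∑ _i : ι, B := sum_le_sum fun i _ => hf i
    _ = Fintype.card ι * B := by simp

/-- A measurable supremum of a uniformly bounded family is integrable. -/
theorem integrable_iSup_of_abs_le {α T : Type*} [MeasurableSpace α] {μ : Measure α}
    [IsFiniteMeasure μ] {f : T → α → ℝ} {C : ℝ} (hm : Measurable fun x => ⨆ τ, f τ x)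
    (hf : ∀ τ x, |f τ x| ≤ C) : Integrable (fun x => ⨆ τ, f τ x) μ := by
  refine Integrable.of_bound hm.aestronglyMeasurable |C| (ae_of_all _ fun x => ?_)
  rw [Real.norm_eq_abs, abs_le]
  rcases isEmpty_or_nonempty T with hT | ⟨⟨τ⟩⟩
  · simp
  · have hC := le_abs_self C
    have hbdd : BddAbove (Set.range fun τ => f τ x) :=
      ⟨C, by rintro _ ⟨τ, rfl⟩; exact (abs_le.1 (hf τ x)).2⟩
    constructor
    · exact le_trans (by linarith [(abs_le.1 (hf τ x)).1]) (le_ciSup hbdd τ)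
    · have : Nonempty T := ⟨τ⟩
      exact ciSup_le fun τ => (abs_le.1 (hf τ x)).2.trans hC


/-- decoupling of U-statistics: the expected supremum of the U-statistic
is at most the expected supremum of the split-sample average. -/
theorem stmt5 {𝒳 : Type*} [MeasurableSpace 𝒳] {T : Type*}
    (q : T → 𝒳 → 𝒳 → ℝ)
    (hqm : ∀ τ, Measurable (fun w : 𝒳 × 𝒳 => q τ w.1 w.2))
    (hb : ∃ B : ℝ, ∀ τ x x', |q τ x x'| ≤ B)
    {n : ℕ} (hn : 2 ≤ n) (hev : Even n)
    (D : Measure 𝒳) [IsProbabilityMeasure D]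
    (hm1 : Measurable (fun S : Fin n → 𝒳 =>
      ⨆ τ : T, (2 / ((n : ℝ) * ((n : ℝ) - 1))) *
        ∑ i : Fin n, ∑ j : Fin n, if i < j then q τ (S i) (S j) else 0))
    (hm2 : Measurable (fun S : Fin n → 𝒳 =>
      ⨆ τ : T, (2 / (n : ℝ)) * ∑ i : Fin (n / 2),
        q τ (S ⟨i.1, by have := i.isLt; omega⟩) (S ⟨n / 2 + i.1, by have := i.isLt; omega⟩))) :
    (∫ S, (⨆ τ : T, (2 / ((n : ℝ) * ((n : ℝ) - 1))) *
        ∑ i : Fin n, ∑ j : Fin n, if i < j then q τ (S i) (S j) else 0)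
      ∂(Measure.pi fun _ : Fin n => D)) ≤
    ∫ S, (⨆ τ : T, (2 / (n : ℝ)) * ∑ i : Fin (n / 2),
        q τ (S ⟨i.1, by have := i.isLt; omega⟩) (S ⟨n / 2 + i.1, by have := i.isLt; omega⟩))
      ∂(Measure.pi fun _ : Fin n => D) := by
  obtain ⟨B, hB⟩ := hb
  let lo : Fin (n / 2) → Fin n := fun i => ⟨i.1, by have := i.isLt; omega⟩
  let hi : Fin (n / 2) → Fin n := fun i => ⟨n / 2 + i.1, by have := i.isLt; omega⟩
  let G : T → (Fin n → 𝒳) → ℝ := fun τ S => (2 / (n : ℝ)) * ∑ i, q τ (S (lo i)) (S (hi i))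
  let F : (Fin n → 𝒳) → ℝ := fun S => ⨆ τ, G τ S
  have hGb : ∀ τ S, |G τ S| ≤ |2 / (n : ℝ)| * (Fintype.card (Fin (n / 2)) * B) :=
    fun τ S => abs_mul_sum_le _ _ fun i => hB _ _ _
  have hF : Integrable F (Measure.pi fun _ : Fin n => D) := integrable_iSup_of_abs_le hm2 hGb
  choose φ hφ using exists_perm_min_max hev
  have hmp : ∀ σ, MeasurePreserving (fun S : Fin n → 𝒳 => S ∘ φ σ)
      (Measure.pi fun _ => D) (Measure.pi fun _ => D) :=
    fun σ => measurePreserving_comp_perm D (φ σ)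
  have hFσ : ∀ σ, Integrable (fun S : Fin n → 𝒳 => F (S ∘ φ σ)) (Measure.pi fun _ => D) :=
    fun σ => (hmp σ).integrable_comp_of_integrable hF
  have hIσ : ∀ σ, ∫ S, F (S ∘ φ σ) ∂(Measure.pi fun _ : Fin n => D) =
      ∫ S, F S ∂(Measure.pi fun _ : Fin n => D) := by
    intro σ
    conv_rhs => rw [← (hmp σ).map_eq]
    rw [integral_map (hmp σ).measurable.aemeasurable hm2.aestronglyMeasurable]
  have hN : (Fintype.card (Equiv.Perm (Fin n)) : ℝ) ≠ 0 := by
    exact_mod_cast Fintype.card_ne_zero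
  have havg : ∀ τ (S : Fin n → 𝒳), (2 / ((n : ℝ) * ((n : ℝ) - 1))) *
      ∑ i : Fin n, ∑ j : Fin n, (if i < j then q τ (S i) (S j) else 0) =
      (Fintype.card (Equiv.Perm (Fin n)) : ℝ)⁻¹ *
        ∑ σ : Equiv.Perm (Fin n), G τ (S ∘ φ σ) := by
    intro τ S
    rw [sum_lt_eq_average_matching hn hev (fun i j => q τ (S i) (S j)) lo hi
      fun i h => by have := i.isLt; have := congrArg Fin.val h; simp only [lo, hi] at this; omega]
    congr 1
    refine sum_congr rfl fun σ _ => ?_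
    simp only [G, Function.comp_apply]
    congr 1
    refine sum_congr rfl fun i _ => ?_
    obtain ⟨h1, h2⟩ := hφ σ (lo i) (hi i) i.isLt rfl
    rw [h1, h2]
  have hbdd : ∀ S, BddAbove (Set.range fun τ => G τ S) := fun S =>
    ⟨|2 / (n : ℝ)| * (Fintype.card (Fin (n / 2)) * B),
      by rintro _ ⟨τ, rfl⟩; exact (abs_le.1 (hGb τ S)).2⟩
  calc _ ≤ ∫ S, (Fintype.card (Equiv.Perm (Fin n)) : ℝ)⁻¹ *
          ∑ σ : Equiv.Perm (Fin n), F (S ∘ φ σ) ∂(Measure.pi fun _ : Fin n => D) := by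
        refine integral_mono ?_ ((integrable_finsetSum _ fun σ _ => hFσ σ).const_mul _) ?_
        · refine integrable_iSup_of_abs_le (C := |(Fintype.card (Equiv.Perm (Fin n)) : ℝ)⁻¹| *
            (Fintype.card (Equiv.Perm (Fin n)) *
              (|2 / (n : ℝ)| * (Fintype.card (Fin (n / 2)) * B)))) hm1 fun τ S => ?_
          rw [havg]
          exact abs_mul_sum_le _ _ fun σ => hGb τ _
        · intro S
          simp only [havg]
          rcases isEmpty_or_nonempty T with hT | hT
          · simp [F]
          · refine ciSup_le fun τ => ?_
            gcongr with σ
            exact le_ciSup (hbdd _) τ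
    _ = ∫ S, F S ∂(Measure.pi fun _ : Fin n => D) := by
        rw [integral_const_mul, integral_finsetSum _ fun σ _ => hFσ σ,
          sum_congr rfl fun σ _ => hIσ σ, sum_const, card_univ, nsmul_eq_mul,
          inv_mul_cancel_left₀ hN]
end
end
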